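/- arXiv:1604.06637 — 4 statements merged into one kernel-verified Lean document; each statement's English description precedes it below -/
import Mathlib

section
/- Equality case of the Hölder-type inequality: assume the integrals ∫∫ g(y|x)^{1+γ} g(x) dy dx and ∫∫ f(y|x)^{1+γ} g(x) dy dx are finite and positive. Then ∫∫ g(y|x) f(y|x)^γ g(x) dy dx = (∫∫ g(y|x)^{1+γ} g(x) dy dx)^{1/(1+γ)} · (∫∫ f(y|x)^{1+γ} g(x) dy dx)^{γ/(1+γ)} holds if and only if g(y|x) = f(y|x) for almost every (x,y) with respect to the measure g(x)dx⊗dy. -/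
open MeasureTheory
open scoped ENNReal

/-- The double integral `∫∫ p(y|x) f(y|x)^γ w(x) dy dx` (with respect to Lebesgue
measure `dy` on `ℝ` and the measure `w(x)dx` on `ℝ^d`), as a Lebesgue integral
in `ℝ≥0∞`.  Note that `J d γ f f w = ∫∫ f(y|x)^{1+γ} w(x) dy dx`. -/
noncomputable def J (d : ℕ) (γ : ℝ) (p f : (Fin d → ℝ) → ℝ → ℝ)
    (w : (Fin d → ℝ) → ℝ) : ℝ≥0∞ :=
  ∫⁻ x : Fin d → ℝ,
    (∫⁻ y : ℝ, ENNReal.ofReal (p x y) * ENNReal.ofReal (f x y) ^ γ) *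
      ENNReal.ofReal (w x)

/-- Equality case of the weighted AM-GM inequality for two numbers. -/
lemma eq_of_rpow_mul_rpow_eq {a b U V : ℝ} (ha : 0 < a) (hb : 0 < b) (hab : a + b = 1)
    (hU : 0 ≤ U) (hV : 0 ≤ V) (h : U ^ a * V ^ b = a * U + b * V) : U = V := by
  have key := (Real.geom_mean_eq_arith_mean_weighted_iff_of_pos Finset.univ ![a, b] ![U, V]
    (by simp [Fin.forall_fin_two, ha, hb]) (by simpa [Fin.sum_univ_two] using hab)
    (by simp [Fin.forall_fin_two, hU, hV])).1
    (by simpa [Fin.sum_univ_two, Fin.prod_univ_two] using h)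
  simpa using key 0 (Finset.mem_univ _) 1 (Finset.mem_univ _)

/-- Equality in Hölder's inequality for the exponents `1 + γ` and `(1 + γ) / γ` forces
proportionality almost everywhere. -/
lemma exists_ae_eq_mul_of_integral_mul_rpow_eq {α : Type*} [MeasurableSpace α] {μ : Measure α}
    {γ : ℝ} (hγ : 0 < γ) {u v : α → ℝ} (hu : Measurable u) (hv : Measurable v)
    (hu0 : ∀ x, 0 ≤ u x) (hv0 : ∀ x, 0 ≤ v x)
    (hui : Integrable (fun x => u x ^ (1 + γ)) μ) (hvi : Integrable (fun x => v x ^ (1 + γ)) μ)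
    (hA : 0 < ∫ x, u x ^ (1 + γ) ∂μ) (hB : 0 < ∫ x, v x ^ (1 + γ) ∂μ)
    (h : ∫ x, u x * v x ^ γ ∂μ =
      (∫ x, u x ^ (1 + γ) ∂μ) ^ (1 / (1 + γ)) * (∫ x, v x ^ (1 + γ) ∂μ) ^ (γ / (1 + γ))) :
    ∃ c : ℝ, ∀ᵐ x ∂μ, u x = c * v x := by
  set A := ∫ x, u x ^ (1 + γ) ∂μ with hAdef
  set B := ∫ x, v x ^ (1 + γ) ∂μ with hBdef
  have hp : 0 < 1 + γ := by linarith
  set a := 1 / (1 + γ) with ha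
  set b := γ / (1 + γ) with hb
  have ha0 : 0 < a := by positivity
  have hb0 : 0 < b := by positivity
  have hab : a + b = 1 := by rw [ha, hb]; field_simp
  have hpa : (1 + γ) * a = 1 := by rw [ha]; field_simp
  have hpb : (1 + γ) * b = γ := by rw [hb]; field_simp
  set C := A ^ a * B ^ b with hC
  have hC0 : 0 < C := by positivity
  have hU0 : ∀ x, 0 ≤ u x ^ (1 + γ) / A := fun x => div_nonneg (Real.rpow_nonneg (hu0 x) _) hA.le
  have hV0 : ∀ x, 0 ≤ v x ^ (1 + γ) / B := fun x => div_nonneg (Real.rpow_nonneg (hv0 x) _) hB.le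
  have hprod : ∀ x, (u x ^ (1 + γ) / A) ^ a * (v x ^ (1 + γ) / B) ^ b = u x * v x ^ γ / C := by
    intro x
    rw [Real.div_rpow (Real.rpow_nonneg (hu0 x) _) hA.le,
      Real.div_rpow (Real.rpow_nonneg (hv0 x) _) hB.le, ← Real.rpow_mul (hu0 x),
      ← Real.rpow_mul (hv0 x), hpa, hpb, Real.rpow_one, hC, div_mul_div_comm]
  have hle : ∀ x, u x * v x ^ γ / C ≤ a * (u x ^ (1 + γ) / A) + b * (v x ^ (1 + γ) / B) := by
    intro x
    rw [← hprod]
    exact Real.geom_mean_le_arith_mean2_weighted ha0.le hb0.le (hU0 x) (hV0 x) hab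
  have hsum : Integrable (fun x => a * (u x ^ (1 + γ) / A) + b * (v x ^ (1 + γ) / B)) μ :=
    ((hui.div_const A).const_mul a).add ((hvi.div_const B).const_mul b)
  have hmul : Integrable (fun x => u x * v x ^ γ / C) μ := by
    refine hsum.mono' (by fun_prop) (.of_forall fun x => ?_)
    rw [Real.norm_of_nonneg
      (div_nonneg (mul_nonneg (hu0 x) (Real.rpow_nonneg (hv0 x) _)) hC0.le)]
    exact hle x
  have hint : ∫ x, (a * (u x ^ (1 + γ) / A) + b * (v x ^ (1 + γ) / B)) - u x * v x ^ γ / C ∂μ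
      = 0 := by
    rw [integral_sub hsum hmul,
      integral_add ((hui.div_const A).const_mul a) ((hvi.div_const B).const_mul b),
      integral_const_mul, integral_const_mul, integral_div, integral_div, integral_div, h,
      ← hAdef, ← hBdef, div_self hA.ne', div_self hB.ne', div_self hC0.ne']
    linarith
  have hzero := (integral_eq_zero_iff_of_nonneg (fun x => sub_nonneg.2 (hle x))
    (hsum.sub hmul)).1 hint
  refine ⟨(A / B) ^ a, hzero.mono fun x hx => ?_⟩
  have hUV := eq_of_rpow_mul_rpow_eq ha0 hb0 hab (hU0 x) (hV0 x)
    ((hprod x).trans (sub_eq_zero.1 hx).symm)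
  have hpow : u x ^ (1 + γ) = A / B * v x ^ (1 + γ) := by
    field_simp at hUV ⊢
    linarith
  calc u x = (u x ^ (1 + γ)) ^ a := by rw [← Real.rpow_mul (hu0 x), hpa, Real.rpow_one]
    _ = (A / B) ^ a * v x := by
      rw [hpow, Real.mul_rpow (by positivity) (Real.rpow_nonneg (hv0 x) _),
        ← Real.rpow_mul (hv0 x), hpa, Real.rpow_one]

lemma J_eq_lintegral_prod {d : ℕ} {γ : ℝ} (hγ : 0 < γ) {p f : (Fin d → ℝ) → ℝ → ℝ}
    {w : (Fin d → ℝ) → ℝ} (hp : Measurable (Function.uncurry p))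
    (hf : Measurable (Function.uncurry f)) (hw : Measurable w)
    (hp0 : ∀ x y, 0 ≤ p x y) (hf0 : ∀ x y, 0 ≤ f x y) :
    J d γ p f w = ∫⁻ z, ENNReal.ofReal (p z.1 z.2 * f z.1 z.2 ^ γ)
      ∂((volume.withDensity fun x => ENNReal.ofReal (w x)).prod (volume : Measure ℝ)) := by
  have hp' : Measurable fun z : (Fin d → ℝ) × ℝ => p z.1 z.2 := hp
  have hf' : Measurable fun z : (Fin d → ℝ) × ℝ => f z.1 z.2 := hf
  have hm : Measurable fun z : (Fin d → ℝ) × ℝ =>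
      ENNReal.ofReal (p z.1 z.2 * f z.1 z.2 ^ γ) := by fun_prop
  rw [lintegral_prod _ hm.aemeasurable,
    lintegral_withDensity_eq_lintegral_mul _ (by fun_prop) hm.lintegral_prod_right', J]
  refine lintegral_congr fun x => ?_
  rw [Pi.mul_apply, mul_comm]
  congr 1
  refine lintegral_congr fun y => ?_
  rw [ENNReal.ofReal_mul (hp0 x y), ENNReal.ofReal_rpow_of_nonneg (hf0 x y) hγ.le]

/-- Equality case of the Hölder-type inequality: assuming
`∫∫ g(y|x)^{1+γ} g(x) dy dx` and `∫∫ f(y|x)^{1+γ} g(x) dy dx` are finite and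
positive, equality
`∫∫ g f^γ g(x) = (∫∫ g^{1+γ} g(x))^{1/(1+γ)} (∫∫ f^{1+γ} g(x))^{γ/(1+γ)}`
holds iff `g(y|x) = f(y|x)` for a.e. `(x,y)` w.r.t. `g(x)dx ⊗ dy`. -/
theorem holder_gamma_equality_case {d : ℕ} {γ : ℝ} (hγ : 0 < γ)
    (g f : (Fin d → ℝ) → ℝ → ℝ) (gx : (Fin d → ℝ) → ℝ)
    (hg_meas : Measurable (Function.uncurry g))
    (hf_meas : Measurable (Function.uncurry f))
    (hgx_meas : Measurable gx)
    (hg_nonneg : ∀ x y, 0 ≤ g x y) (hf_nonneg : ∀ x y, 0 ≤ f x y)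
    (hgx_nonneg : ∀ x, 0 ≤ gx x)
    (hg_dens : ∀ᵐ x : Fin d → ℝ ∂volume, ∫ y : ℝ, g x y = 1)
    (hf_dens : ∀ᵐ x : Fin d → ℝ ∂volume, ∫ y : ℝ, f x y = 1)
    (hgx_int : Integrable gx) (hgx_prob : ∫ x : Fin d → ℝ, gx x = 1)
    (hgg_pos : 0 < J d γ g g gx) (hgg_fin : J d γ g g gx ≠ ⊤)
    (hff_pos : 0 < J d γ f f gx) (hff_fin : J d γ f f gx ≠ ⊤) :
    J d γ g f gx =
        J d γ g g gx ^ (1 / (1 + γ)) * J d γ f f gx ^ (γ / (1 + γ)) ↔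
      (∀ᵐ p : (Fin d → ℝ) × ℝ
          ∂((volume.withDensity fun x => ENNReal.ofReal (gx x)).prod
            (volume : Measure ℝ)),
        g p.1 p.2 = f p.1 p.2) := by
  have hp : 0 < 1 + γ := by linarith
  have hJgg := J_eq_lintegral_prod hγ hg_meas hg_meas hgx_meas hg_nonneg hg_nonneg
  have hJff := J_eq_lintegral_prod hγ hf_meas hf_meas hgx_meas hf_nonneg hf_nonneg
  have hJgf := J_eq_lintegral_prod hγ hg_meas hf_meas hgx_meas hg_nonneg hf_nonneg
  set ν : Measure (Fin d → ℝ) := volume.withDensity fun x => ENNReal.ofReal (gx x) with hν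
  have hg : Measurable fun z : (Fin d → ℝ) × ℝ => g z.1 z.2 := hg_meas
  have hf : Measurable fun z : (Fin d → ℝ) × ℝ => f z.1 z.2 := hf_meas
  have hpow : ∀ {t : ℝ}, 0 ≤ t → t * t ^ γ = t ^ (1 + γ) := fun ht => by
    rw [Real.rpow_add' ht hp.ne', Real.rpow_one]
  constructor
  · intro h
    simp only [hpow (hg_nonneg _ _)] at hJgg
    simp only [hpow (hf_nonneg _ _)] at hJff
    have hgp : ∀ z : (Fin d → ℝ) × ℝ, 0 ≤ g z.1 z.2 ^ (1 + γ) :=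
      fun z => Real.rpow_nonneg (hg_nonneg _ _) _
    have hfp : ∀ z : (Fin d → ℝ) × ℝ, 0 ≤ f z.1 z.2 ^ (1 + γ) :=
      fun z => Real.rpow_nonneg (hf_nonneg _ _) _
    have hgm : Measurable fun z : (Fin d → ℝ) × ℝ => g z.1 z.2 ^ (1 + γ) := by fun_prop
    have hfm : Measurable fun z : (Fin d → ℝ) × ℝ => f z.1 z.2 ^ (1 + γ) := by fun_prop
    have hgfm : Measurable fun z : (Fin d → ℝ) × ℝ => g z.1 z.2 * f z.1 z.2 ^ γ := by fun_prop
    have hgi : ∫ z, g z.1 z.2 ^ (1 + γ) ∂(ν.prod volume) = (J d γ g g gx).toReal := by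
      rw [hJgg, integral_eq_lintegral_of_nonneg_ae (.of_forall hgp) hgm.aestronglyMeasurable]
    have hfi : ∫ z, f z.1 z.2 ^ (1 + γ) ∂(ν.prod volume) = (J d γ f f gx).toReal := by
      rw [hJff, integral_eq_lintegral_of_nonneg_ae (.of_forall hfp) hfm.aestronglyMeasurable]
    have hgfi : ∫ z, g z.1 z.2 * f z.1 z.2 ^ γ ∂(ν.prod volume) = (J d γ g f gx).toReal := by
      rw [hJgf, integral_eq_lintegral_of_nonneg_ae (.of_forall fun z =>
        mul_nonneg (hg_nonneg _ _) (Real.rpow_nonneg (hf_nonneg _ _) _))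
        hgfm.aestronglyMeasurable]
    obtain ⟨c, hc⟩ := exists_ae_eq_mul_of_integral_mul_rpow_eq (μ := ν.prod volume) hγ hg hf
      (fun z => hg_nonneg _ _) (fun z => hf_nonneg _ _)
      ((lintegral_ofReal_ne_top_iff_integrable hgm.aestronglyMeasurable (.of_forall hgp)).1
        (hJgg ▸ hgg_fin))
      ((lintegral_ofReal_ne_top_iff_integrable hfm.aestronglyMeasurable (.of_forall hfp)).1
        (hJff ▸ hff_fin))
      (hgi ▸ ENNReal.toReal_pos hgg_pos.ne' hgg_fin)
      (hfi ▸ ENNReal.toReal_pos hff_pos.ne' hff_fin)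
      (by rw [hgi, hfi, hgfi, h, ENNReal.toReal_mul, ENNReal.toReal_rpow, ENNReal.toReal_rpow])
    have hν0 : ν ≠ 0 := fun h0 => by
      have h1 : ν Set.univ = 1 := by
        rw [hν, withDensity_apply _ .univ, setLIntegral_univ,
          ← ofReal_integral_eq_lintegral_ofReal hgx_int (.of_forall hgx_nonneg), hgx_prob,
          ENNReal.ofReal_one]
      simp [h0] at h1
    have hac : ν ≪ volume := withDensity_absolutelyContinuous _ _
    have : (ae ν).NeBot := ae_neBot.2 hν0
    obtain ⟨x, hx, hgx1, hfx1⟩ := ((Measure.ae_ae_of_ae_prod hc).and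
      ((hg_dens.and hf_dens).filter_mono hac.ae_le)).exists
    have hc1 : c = 1 := by
      rw [integral_congr_ae hx, integral_const_mul] at hgx1
      simpa only [hfx1, mul_one] using hgx1
    simpa only [hc1, one_mul] using hc
  · intro h
    have hgf : J d γ g f gx = J d γ g g gx := by
      rw [hJgf, hJgg]
      exact lintegral_congr_ae (h.mono fun z hz => by simp only [hz])
    have hff : J d γ f f gx = J d γ g g gx := by
      rw [hJff, hJgg]
      exact lintegral_congr_ae (h.mono fun z hz => by simp only [hz])
    rw [hgf, hff, ← ENNReal.rpow_add _ _ hgg_pos.ne' hgg_fin, ← add_div, div_self hp.ne',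
      ENNReal.rpow_one]
end

section
/- Exact form of Theorem 2 (homogeneous contamination): suppose g(y|x) = (1-ε) f*(y|x) + ε δ(y|x) with ε∈(0,1), that A := ∫∫ f*(y|x) f(y|x)^γ g(x) dy dx is finite and positive, that ν_{f,γ}^γ = ∫∫ δ(y|x) f(y|x)^γ g(x) dy dx is finite, and that ∫∫ f(y|x)^{1+γ} g(x) dy dx is finite and positive. Then d_γ(g(y|x), f(y|x); g(x)) = −(1/γ) log(1−ε) + d_γ(f*(y|x), f(y|x); g(x)) − (1/γ) log(1 + ε ν_{f,γ}^γ / ((1−ε) A)). -/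
open MeasureTheory
open scoped ENNReal

/-- The γ-cross entropy for regression with base weight `w`:
`d_γ(p,f;w) = -(1/γ) log ∫∫ p f^γ w + (1/(1+γ)) log ∫∫ f^{1+γ} w`. -/
noncomputable def dgam (d : ℕ) (γ : ℝ) (p f : (Fin d → ℝ) → ℝ → ℝ)
    (w : (Fin d → ℝ) → ℝ) : ℝ :=
  -(1 / γ) * Real.log (J d γ p f w).toReal +
    (1 / (1 + γ)) * Real.log (J d γ f f w).toReal

/-- `J` is additive and positively homogeneous in its first density argument. -/
theorem J_eq_of_mixture {d : ℕ} {γ : ℝ} {p q f g : (Fin d → ℝ) → ℝ → ℝ}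
    {w : (Fin d → ℝ) → ℝ} {a b : ℝ} (ha : 0 ≤ a) (hb : 0 ≤ b)
    (hp_meas : Measurable (Function.uncurry p)) (hq_meas : Measurable (Function.uncurry q))
    (hf_meas : Measurable (Function.uncurry f)) (hw_meas : Measurable w)
    (hp : ∀ x y, 0 ≤ p x y) (hq : ∀ x y, 0 ≤ q x y)
    (hg : ∀ x y, g x y = a * p x y + b * q x y) :
    J d γ g f w = ENNReal.ofReal a * J d γ p f w + ENNReal.ofReal b * J d γ q f w := by
  have integrand_meas : ∀ r : (Fin d → ℝ) → ℝ → ℝ, Measurable (Function.uncurry r) →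
      Measurable (Function.uncurry fun x y =>
        ENNReal.ofReal (r x y) * ENNReal.ofReal (f x y) ^ γ) := fun r hr =>
    hr.ennreal_ofReal.mul (hf_meas.ennreal_ofReal.pow_const γ)
  have hP := integrand_meas p hp_meas
  have hQ := integrand_meas q hq_meas
  have hPw : Measurable fun x =>
      (∫⁻ y : ℝ, ENNReal.ofReal (p x y) * ENNReal.ofReal (f x y) ^ γ) *
        ENNReal.ofReal (w x) :=
    hP.lintegral_prod_right.mul hw_meas.ennreal_ofReal
  have hQw : Measurable fun x =>
      (∫⁻ y : ℝ, ENNReal.ofReal (q x y) * ENNReal.ofReal (f x y) ^ γ) *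
        ENNReal.ofReal (w x) :=
    hQ.lintegral_prod_right.mul hw_meas.ennreal_ofReal
  have inner : ∀ x, ∫⁻ y : ℝ, ENNReal.ofReal (g x y) * ENNReal.ofReal (f x y) ^ γ =
      ENNReal.ofReal a * (∫⁻ y : ℝ, ENNReal.ofReal (p x y) * ENNReal.ofReal (f x y) ^ γ) +
        ENNReal.ofReal b * ∫⁻ y : ℝ, ENNReal.ofReal (q x y) * ENNReal.ofReal (f x y) ^ γ := by
    intro x
    have hPx : Measurable fun y => ENNReal.ofReal (p x y) * ENNReal.ofReal (f x y) ^ γ :=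
      hP.of_uncurry_left
    have hQx : Measurable fun y => ENNReal.ofReal (q x y) * ENNReal.ofReal (f x y) ^ γ :=
      hQ.of_uncurry_left
    rw [← lintegral_const_mul _ hPx, ← lintegral_const_mul _ hQx,
      ← lintegral_add_left (hPx.const_mul _)]
    refine lintegral_congr fun y => ?_
    rw [hg, ENNReal.ofReal_add (mul_nonneg ha (hp x y)) (mul_nonneg hb (hq x y)),
      ENNReal.ofReal_mul ha, ENNReal.ofReal_mul hb]
    ring
  unfold J
  rw [← lintegral_const_mul _ hPw, ← lintegral_const_mul _ hQw,
    ← lintegral_add_left (hPw.const_mul _)]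
  refine lintegral_congr fun x => ?_
  rw [inner]
  ring

/-- Exact form of Theorem 2 (homogeneous contamination):
`d_γ(g,f;g(x)) = −(1/γ)log(1−ε) + d_γ(f*,f;g(x)) − (1/γ)log(1 + ε ν_{f,γ}^γ /((1−ε)A))`
where `A = ∫∫ f* f^γ g(x) dy dx` and `ν_{f,γ}^γ = ∫∫ δ f^γ g(x) dy dx`. -/
theorem gamma_cross_entropy_homogeneous_exact {d : ℕ} {γ : ℝ} (hγ : 0 < γ)
    (fstar δ f g : (Fin d → ℝ) → ℝ → ℝ) (gx : (Fin d → ℝ) → ℝ) (ε : ℝ)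
    (hε : ε ∈ Set.Ioo (0 : ℝ) 1)
    (hfstar_meas : Measurable (Function.uncurry fstar))
    (hδ_meas : Measurable (Function.uncurry δ))
    (hf_meas : Measurable (Function.uncurry f))
    (hgx_meas : Measurable gx)
    (hfstar_nonneg : ∀ x y, 0 ≤ fstar x y) (hδ_nonneg : ∀ x y, 0 ≤ δ x y)
    (hf_nonneg : ∀ x y, 0 ≤ f x y) (hgx_nonneg : ∀ x, 0 ≤ gx x)
    (hfstar_dens : ∀ᵐ x : Fin d → ℝ ∂volume, ∫ y : ℝ, fstar x y = 1)
    (hδ_dens : ∀ᵐ x : Fin d → ℝ ∂volume, ∫ y : ℝ, δ x y = 1)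
    (hf_dens : ∀ᵐ x : Fin d → ℝ ∂volume, ∫ y : ℝ, f x y = 1)
    (hgx_int : Integrable gx) (hgx_prob : ∫ x : Fin d → ℝ, gx x = 1)
    -- homogeneous contamination
    (hg : ∀ x y, g x y = (1 - ε) * fstar x y + ε * δ x y)
    -- finiteness and positivity assumptions
    (hA_pos : 0 < J d γ fstar f gx) (hA_fin : J d γ fstar f gx ≠ ⊤)
    (hν_fin : J d γ δ f gx ≠ ⊤)
    (hff_pos : 0 < J d γ f f gx) (hff_fin : J d γ f f gx ≠ ⊤) :
    dgam d γ g f gx =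
      -(1 / γ) * Real.log (1 - ε) + dgam d γ fstar f gx -
        (1 / γ) * Real.log
          (1 + ε * (J d γ δ f gx).toReal /
            ((1 - ε) * (J d γ fstar f gx).toReal)) := by
  obtain ⟨hε0, hε1⟩ := hε
  have h1ε : 0 < 1 - ε := sub_pos.2 hε1
  have hA : 0 < (J d γ fstar f gx).toReal := ENNReal.toReal_pos hA_pos.ne' hA_fin
  have hν : 0 ≤ (J d γ δ f gx).toReal := ENNReal.toReal_nonneg
  have hJ : (J d γ g f gx).toReal = (1 - ε) * (J d γ fstar f gx).toReal *
      (1 + ε * (J d γ δ f gx).toReal / ((1 - ε) * (J d γ fstar f gx).toReal)) := by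
    rw [J_eq_of_mixture h1ε.le hε0.le hfstar_meas hδ_meas hf_meas hgx_meas
      hfstar_nonneg hδ_nonneg hg,
      ENNReal.toReal_add (ENNReal.mul_ne_top ENNReal.ofReal_ne_top hA_fin)
        (ENNReal.mul_ne_top ENNReal.ofReal_ne_top hν_fin),
      ENNReal.toReal_mul, ENNReal.toReal_mul, ENNReal.toReal_ofReal h1ε.le,
      ENNReal.toReal_ofReal hε0.le]
    field_simp
  unfold dgam
  rw [hJ, Real.log_mul (by positivity) (by positivity), Real.log_mul h1ε.ne' hA.ne']
  ring
end

section
/- Theorem 2 (approximate Pythagorean relation under homogeneous contamination, quantitative form): suppose g(y|x) = (1-ε) f*(y|x) + ε δ(y|x) with ε∈(0,1). Let A_f := ∫∫ f*(y|x) f(y|x)^γ g(x) dy dx and A_* := ∫∫ f*(y|x)^{1+γ} g(x) dy dx, and assume A_f, A_*, ∫∫ f(y|x)^{1+γ} g(x) dy dx are finite and positive and ν_{f,γ}^γ, ν_{f*,γ}^γ are finite. Then |D_γ(g, f; g(x)) − D_γ(g, f*; g(x)) − D_γ(f*, f; g(x))| ≤ (ε/(γ(1−ε))) · (ν_{f,γ}^γ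 / A_f + ν_{f*,γ}^γ / A_*). -/
open MeasureTheory
open scoped ENNReal

/-- The γ-divergence for regression: `D_γ(p,f;w) = d_γ(p,f;w) - d_γ(p,p;w)`. -/
noncomputable def Dgam (d : ℕ) (γ : ℝ) (p f : (Fin d → ℝ) → ℝ → ℝ)
    (w : (Fin d → ℝ) → ℝ) : ℝ :=
  dgam d γ p f w - dgam d γ p p w

/-- The double integral is affine in the contaminated density. -/
lemma J_contaminated {d : ℕ} {γ ε : ℝ} (hε : ε ∈ Set.Ioo (0 : ℝ) 1)
    {p q r f : (Fin d → ℝ) → ℝ → ℝ} {w : (Fin d → ℝ) → ℝ}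
    (hp_meas : Measurable (Function.uncurry p))
    (hf_meas : Measurable (Function.uncurry f)) (hw_meas : Measurable w)
    (hp_nonneg : ∀ x y, 0 ≤ p x y) (hq_nonneg : ∀ x y, 0 ≤ q x y)
    (hr : ∀ x y, r x y = (1 - ε) * p x y + ε * q x y) :
    J d γ r f w = ENNReal.ofReal (1 - ε) * J d γ p f w + ENNReal.ofReal ε * J d γ q f w := by
  have h₁ : 0 ≤ 1 - ε := sub_nonneg.2 hε.2.le
  have hmeas : Measurable (Function.uncurry fun x y =>
      ENNReal.ofReal (p x y) * ENNReal.ofReal (f x y) ^ γ) :=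
    hp_meas.ennreal_ofReal.mul (hf_meas.ennreal_ofReal.pow_const γ)
  have hpoint : ∀ x y, ENNReal.ofReal (r x y) * ENNReal.ofReal (f x y) ^ γ =
      ENNReal.ofReal (1 - ε) * (ENNReal.ofReal (p x y) * ENNReal.ofReal (f x y) ^ γ) +
        ENNReal.ofReal ε * (ENNReal.ofReal (q x y) * ENNReal.ofReal (f x y) ^ γ) := by
    intro x y
    rw [hr, ENNReal.ofReal_add (mul_nonneg h₁ (hp_nonneg x y))
      (mul_nonneg hε.1.le (hq_nonneg x y)), ENNReal.ofReal_mul h₁, ENNReal.ofReal_mul hε.1.le]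
    ring
  have hinner : ∀ x, (∫⁻ y : ℝ, ENNReal.ofReal (r x y) * ENNReal.ofReal (f x y) ^ γ) *
        ENNReal.ofReal (w x) =
      ENNReal.ofReal (1 - ε) *
          ((∫⁻ y : ℝ, ENNReal.ofReal (p x y) * ENNReal.ofReal (f x y) ^ γ) *
            ENNReal.ofReal (w x)) +
        ENNReal.ofReal ε *
          ((∫⁻ y : ℝ, ENNReal.ofReal (q x y) * ENNReal.ofReal (f x y) ^ γ) *
            ENNReal.ofReal (w x)) := by
    intro x
    have hx : Measurable fun y => ENNReal.ofReal (p x y) * ENNReal.ofReal (f x y) ^ γ :=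
      hmeas.comp measurable_prodMk_left
    simp_rw [hpoint]
    rw [lintegral_add_left (hx.const_mul _), lintegral_const_mul' _ _ ENNReal.ofReal_ne_top,
      lintegral_const_mul' _ _ ENNReal.ofReal_ne_top]
    ring
  have houter : Measurable fun x =>
      (∫⁻ y : ℝ, ENNReal.ofReal (p x y) * ENNReal.ofReal (f x y) ^ γ) * ENNReal.ofReal (w x) :=
    (Measurable.lintegral_prod_right hmeas).mul hw_meas.ennreal_ofReal
  unfold J
  simp_rw [hinner]
  rw [lintegral_add_left (houter.const_mul _), lintegral_const_mul' _ _ ENNReal.ofReal_ne_top,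
    lintegral_const_mul' _ _ ENNReal.ofReal_ne_top]

lemma toReal_J_contaminated {d : ℕ} {γ ε : ℝ} (hε : ε ∈ Set.Ioo (0 : ℝ) 1)
    {p q r f : (Fin d → ℝ) → ℝ → ℝ} {w : (Fin d → ℝ) → ℝ}
    (hp_meas : Measurable (Function.uncurry p))
    (hf_meas : Measurable (Function.uncurry f)) (hw_meas : Measurable w)
    (hp_nonneg : ∀ x y, 0 ≤ p x y) (hq_nonneg : ∀ x y, 0 ≤ q x y)
    (hr : ∀ x y, r x y = (1 - ε) * p x y + ε * q x y)
    (hp_fin : J d γ p f w ≠ ⊤) (hq_fin : J d γ q f w ≠ ⊤) :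
    (J d γ r f w).toReal = (1 - ε) * (J d γ p f w).toReal + ε * (J d γ q f w).toReal := by
  rw [J_contaminated hε hp_meas hf_meas hw_meas hp_nonneg hq_nonneg hr,
    ENNReal.toReal_add (ENNReal.mul_ne_top ENNReal.ofReal_ne_top hp_fin)
      (ENNReal.mul_ne_top ENNReal.ofReal_ne_top hq_fin),
    ENNReal.toReal_mul, ENNReal.toReal_mul, ENNReal.toReal_ofReal (sub_nonneg.2 hε.2.le),
    ENNReal.toReal_ofReal hε.1.le]

/-- Contaminating `a` by `b` shifts its logarithm by `log (1 - ε)` up to a nonnegative error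
that is at most the relative size of the contamination. -/
lemma log_contaminated_mem_Icc {ε a b : ℝ} (hε : ε ∈ Set.Ioo (0 : ℝ) 1) (ha : 0 < a)
    (hb : 0 ≤ b) :
    Real.log ((1 - ε) * a + ε * b) - Real.log a - Real.log (1 - ε) ∈
      Set.Icc 0 (ε / (1 - ε) * (b / a)) := by
  have h₁ : 0 < 1 - ε := sub_pos.2 hε.2
  have hu : 0 ≤ ε / (1 - ε) * (b / a) :=
    mul_nonneg (div_nonneg hε.1.le h₁.le) (div_nonneg hb ha.le)
  have hfactor : (1 - ε) * a + ε * b = (1 - ε) * a * (1 + ε / (1 - ε) * (b / a)) := by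
    field_simp
  have hlog : Real.log ((1 - ε) * a + ε * b) - Real.log a - Real.log (1 - ε) =
      Real.log (1 + ε / (1 - ε) * (b / a)) := by
    rw [hfactor, Real.log_mul (by positivity) (by positivity), Real.log_mul h₁.ne' ha.ne']
    ring
  rw [hlog]
  refine ⟨Real.log_nonneg (by linarith), ?_⟩
  linarith [Real.log_le_sub_one_of_pos (show 0 < 1 + ε / (1 - ε) * (b / a) by linarith)]

/-- Theorem 2 (approximate Pythagorean relation under homogeneous contamination,
quantitative form):
`|D_γ(g,f;g(x)) − D_γ(g,f*;g(x)) − D_γ(f*,f;g(x))|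
  ≤ (ε/(γ(1−ε))) (ν_{f,γ}^γ/A_f + ν_{f*,γ}^γ/A_*)`. -/
theorem pythagorean_homogeneous {d : ℕ} {γ : ℝ} (hγ : 0 < γ)
    (fstar δ f g : (Fin d → ℝ) → ℝ → ℝ) (gx : (Fin d → ℝ) → ℝ) (ε : ℝ)
    (hε : ε ∈ Set.Ioo (0 : ℝ) 1)
    (hfstar_meas : Measurable (Function.uncurry fstar))
    (hδ_meas : Measurable (Function.uncurry δ))
    (hf_meas : Measurable (Function.uncurry f))
    (hgx_meas : Measurable gx)
    (hfstar_nonneg : ∀ x y, 0 ≤ fstar x y) (hδ_nonneg : ∀ x y, 0 ≤ δ x y)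
    (hf_nonneg : ∀ x y, 0 ≤ f x y) (hgx_nonneg : ∀ x, 0 ≤ gx x)
    (hfstar_dens : ∀ᵐ x : Fin d → ℝ ∂volume, ∫ y : ℝ, fstar x y = 1)
    (hδ_dens : ∀ᵐ x : Fin d → ℝ ∂volume, ∫ y : ℝ, δ x y = 1)
    (hf_dens : ∀ᵐ x : Fin d → ℝ ∂volume, ∫ y : ℝ, f x y = 1)
    (hgx_int : Integrable gx) (hgx_prob : ∫ x : Fin d → ℝ, gx x = 1)
    -- homogeneous contamination
    (hg : ∀ x y, g x y = (1 - ε) * fstar x y + ε * δ x y)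
    -- finiteness and positivity assumptions
    (hAf_pos : 0 < J d γ fstar f gx) (hAf_fin : J d γ fstar f gx ≠ ⊤)
    (hAs_pos : 0 < J d γ fstar fstar gx) (hAs_fin : J d γ fstar fstar gx ≠ ⊤)
    (hff_pos : 0 < J d γ f f gx) (hff_fin : J d γ f f gx ≠ ⊤)
    (hνf_fin : J d γ δ f gx ≠ ⊤) (hνs_fin : J d γ δ fstar gx ≠ ⊤) :
    |Dgam d γ g f gx - Dgam d γ g fstar gx - Dgam d γ fstar f gx| ≤
      (ε / (γ * (1 - ε))) *
        ((J d γ δ f gx).toReal / (J d γ fstar f gx).toReal +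
          (J d γ δ fstar gx).toReal / (J d γ fstar fstar gx).toReal) := by
  have hf := log_contaminated_mem_Icc hε (ENNReal.toReal_pos hAf_pos.ne' hAf_fin)
    (ENNReal.toReal_nonneg (a := J d γ δ f gx))
  have hs := log_contaminated_mem_Icc hε (ENNReal.toReal_pos hAs_pos.ne' hAs_fin)
    (ENNReal.toReal_nonneg (a := J d γ δ fstar gx))
  rw [← toReal_J_contaminated hε hfstar_meas hf_meas hgx_meas hfstar_nonneg hδ_nonneg hg
    hAf_fin hνf_fin] at hf
  rw [← toReal_J_contaminated hε hfstar_meas hfstar_meas hgx_meas hfstar_nonneg hδ_nonneg hg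
    hAs_fin hνs_fin] at hs
  have hdecomp : Dgam d γ g f gx - Dgam d γ g fstar gx - Dgam d γ fstar f gx =
      1 / γ *
        ((Real.log (J d γ g fstar gx).toReal - Real.log (J d γ fstar fstar gx).toReal -
            Real.log (1 - ε)) -
          (Real.log (J d γ g f gx).toReal - Real.log (J d γ fstar f gx).toReal -
            Real.log (1 - ε))) := by
    unfold Dgam dgam
    ring
  have hcoef : ε / (γ * (1 - ε)) = 1 / γ * (ε / (1 - ε)) := by
    rw [div_mul_div_comm, one_mul]
  rw [hdecomp, hcoef, mul_assoc, abs_mul, abs_of_pos (one_div_pos.2 hγ), mul_add]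
  refine mul_le_mul_of_nonneg_left ?_ (one_div_pos.2 hγ).le
  rw [abs_le]
  constructor <;> linarith [hf.1, hf.2, hs.1, hs.2]
end

section
/- Proposition 2 (decomposition under heterogeneous contamination in a location-scale family): suppose g(y|x) = (1−ε(x)) f*(y|x) + ε(x) δ(y|x) where ε: ℝ^d→[0,1) is measurable, and f(y|x) = (1/σ) s((y−q(x))/σ) is a location-scale conditional density with ∫ s(z)^{1+γ} dz ∈ (0,∞). Assume ∫∫ f*(y|x) f(y|x)^γ (1−ε(x)) g(x) dy dx and T := ∫ ν_{f,γ}(x)^γ ε(x) g(x) dx are finite and ∫ ε(x) g(x) dx < 1. Then 𝑑̃_γ(g,f;g(x)) = (1 − ∫ ε(x) g(x) dx)^{γ/(1+γ)} · 𝑑̃_γ(f*, f; (1−ε(x)) g(x)) − T / (σ^{−γ} ∫ s(z)^{1+γ} dz)^{γ/(1+γ)}, where 𝑑̃_γ(f*,f;(1−ε(x))g(x)) := −(∫∫ f*(y|x) f(y|x)^γ (1−ε(x)) g(x) dy dx)/(∫∫ f(y|x)^{1+γ} (1−ε(x)) g(x) dy dx)^{γ/(1+γ)}. -/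
open MeasureTheory
open scoped ENNReal

/-- The monotone transform of the γ-cross entropy with base weight `w`:
`𝑑̃_γ(p,f;w) = −(∫∫ p f^γ w)/(∫∫ f^{1+γ} w)^{γ/(1+γ)}`. -/
noncomputable def dtil (d : ℕ) (γ : ℝ) (p f : (Fin d → ℝ) → ℝ → ℝ)
    (w : (Fin d → ℝ) → ℝ) : ℝ :=
  -(J d γ p f w).toReal / (J d γ f f w).toReal ^ (γ / (1 + γ))

/-- The `γ`-power integral of a location-scale density does not depend on the location. -/
lemma lintegral_locationScale_rpow {γ : ℝ} (hγ : 0 < γ) {s : ℝ → ℝ} (hs_nonneg : ∀ z, 0 ≤ s z)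
    (hs_pow_int : Integrable fun z : ℝ => s z ^ (1 + γ)) {σ : ℝ} (hσ : 0 < σ) (m : ℝ) :
    (∫⁻ y : ℝ, ENNReal.ofReal ((1 / σ) * s ((y - m) / σ)) *
        ENNReal.ofReal ((1 / σ) * s ((y - m) / σ)) ^ γ) =
      ENNReal.ofReal (σ ^ (-γ) * ∫ z : ℝ, s z ^ (1 + γ)) := by
  have key : ∀ y : ℝ, ENNReal.ofReal ((1 / σ) * s ((y - m) / σ)) *
      ENNReal.ofReal ((1 / σ) * s ((y - m) / σ)) ^ γ =
      ENNReal.ofReal ((1 / σ) ^ (1 + γ) * s ((y - m) / σ) ^ (1 + γ)) := by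
    intro y
    have h : 0 ≤ (1 / σ) * s ((y - m) / σ) := mul_nonneg (by positivity) (hs_nonneg _)
    rw [ENNReal.ofReal_rpow_of_nonneg h hγ.le, ← ENNReal.ofReal_mul h,
      ← Real.mul_rpow (by positivity) (hs_nonneg _),
      Real.rpow_add_of_nonneg h zero_le_one hγ.le, Real.rpow_one]
  simp_rw [key]
  have hint : Integrable fun y : ℝ => s ((y - m) / σ) ^ (1 + γ) :=
    (hs_pow_int.comp_div hσ.ne').comp_sub_right m
  rw [← ofReal_integral_eq_lintegral_ofReal (hint.const_mul _)
    (ae_of_all _ fun y => mul_nonneg (by positivity) (Real.rpow_nonneg (hs_nonneg _) _)),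
    integral_const_mul, integral_sub_right_eq_self (fun y : ℝ => s (y / σ) ^ (1 + γ)) m,
    Measure.integral_comp_div (fun z : ℝ => s z ^ (1 + γ)) σ, smul_eq_mul, abs_of_pos hσ,
    ← mul_assoc]
  congr 2
  rw [one_div, Real.inv_rpow hσ.le, ← Real.rpow_neg hσ.le]
  nth_rewrite 2 [← Real.rpow_one σ]
  rw [← Real.rpow_add hσ]
  congr 1
  ring

lemma toReal_J_locationScale {d : ℕ} {γ : ℝ} (hγ : 0 < γ) {s : ℝ → ℝ}
    (hs_nonneg : ∀ z, 0 ≤ s z) (hs_pow_int : Integrable fun z : ℝ => s z ^ (1 + γ))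
    {σ : ℝ} (hσ : 0 < σ) (q : (Fin d → ℝ) → ℝ) {f : (Fin d → ℝ) → ℝ → ℝ}
    (hf : ∀ x y, f x y = (1 / σ) * s ((y - q x) / σ)) {w : (Fin d → ℝ) → ℝ}
    (hw_int : Integrable w) (hw_nonneg : ∀ x, 0 ≤ w x) :
    (J d γ f f w).toReal =
      (∫ x : Fin d → ℝ, w x) * (σ ^ (-γ) * ∫ z : ℝ, s z ^ (1 + γ)) := by
  have hK : 0 ≤ σ ^ (-γ) * ∫ z : ℝ, s z ^ (1 + γ) :=
    mul_nonneg (by positivity) (integral_nonneg fun z => Real.rpow_nonneg (hs_nonneg z) _)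
  simp_rw [J, hf, lintegral_locationScale_rpow hγ hs_nonneg hs_pow_int hσ]
  rw [lintegral_const_mul' _ _ ENNReal.ofReal_ne_top,
    ← ofReal_integral_eq_lintegral_ofReal hw_int (ae_of_all _ hw_nonneg), ENNReal.toReal_mul,
    ENNReal.toReal_ofReal hK, ENNReal.toReal_ofReal (integral_nonneg hw_nonneg), mul_comm]

/-- The double integral of a mixture splits, with the mixing ratios moved into the weights. -/
lemma J_mixture {d : ℕ} {γ : ℝ} {p₀ p₁ p f : (Fin d → ℝ) → ℝ → ℝ}
    {w ε : (Fin d → ℝ) → ℝ} (hε_meas : Measurable ε)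
    (hε_nonneg : ∀ x, 0 ≤ ε x) (hε_le : ∀ x, ε x ≤ 1)
    (hp₀_meas : Measurable (Function.uncurry p₀)) (hf_meas : Measurable (Function.uncurry f))
    (hw_meas : Measurable w)
    (hp₀_nonneg : ∀ x y, 0 ≤ p₀ x y) (hp₁_nonneg : ∀ x y, 0 ≤ p₁ x y)
    (hp : ∀ x y, p x y = (1 - ε x) * p₀ x y + ε x * p₁ x y) :
    J d γ p f w =
      J d γ p₀ f (fun x => (1 - ε x) * w x) + J d γ p₁ f (fun x => ε x * w x) := by
  have hmeas : Measurable (Function.uncurry fun x y =>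
      ENNReal.ofReal (p₀ x y) * ENNReal.ofReal (f x y) ^ γ) :=
    hp₀_meas.ennreal_ofReal.mul (hf_meas.ennreal_ofReal.pow_const γ)
  have hinner : Measurable fun x => (∫⁻ y, ENNReal.ofReal (p₀ x y) * ENNReal.ofReal (f x y) ^ γ) *
      ENNReal.ofReal ((1 - ε x) * w x) :=
    hmeas.lintegral_prod_right'.mul (by fun_prop)
  unfold J
  rw [← lintegral_add_left hinner]
  refine lintegral_congr fun x => ?_
  have h1 : 0 ≤ 1 - ε x := sub_nonneg.2 (hε_le x)
  have hpt : ∀ y, ENNReal.ofReal (p x y) * ENNReal.ofReal (f x y) ^ γ =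
      ENNReal.ofReal (1 - ε x) * (ENNReal.ofReal (p₀ x y) * ENNReal.ofReal (f x y) ^ γ) +
      ENNReal.ofReal (ε x) * (ENNReal.ofReal (p₁ x y) * ENNReal.ofReal (f x y) ^ γ) := by
    intro y
    rw [hp, ENNReal.ofReal_add (mul_nonneg h1 (hp₀_nonneg x y))
      (mul_nonneg (hε_nonneg x) (hp₁_nonneg x y)), ENNReal.ofReal_mul h1,
      ENNReal.ofReal_mul (hε_nonneg x)]
    ring
  simp_rw [hpt]
  rw [lintegral_add_left ((hmeas.of_uncurry_left (x := x)).const_mul _),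
    lintegral_const_mul' _ _ ENNReal.ofReal_ne_top,
    lintegral_const_mul' _ _ ENNReal.ofReal_ne_top,
    ENNReal.ofReal_mul h1, ENNReal.ofReal_mul (hε_nonneg x)]
  ring

/-- Proposition 2 (decomposition under heterogeneous contamination in a
location-scale family): if `g(y|x) = (1−ε(x)) f*(y|x) + ε(x) δ(y|x)` and
`f(y|x) = (1/σ) s((y−q(x))/σ)`, then
`𝑑̃_γ(g,f;g(x)) = (1−∫ε(x)g(x)dx)^{γ/(1+γ)} 𝑑̃_γ(f*,f;(1−ε(x))g(x))
  − T/(σ^{−γ}∫s^{1+γ})^{γ/(1+γ)}` where `T = ∫ ν_{f,γ}(x)^γ ε(x) g(x) dx`. -/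
theorem gamma_decomposition_heterogeneous {d : ℕ} {γ : ℝ} (hγ : 0 < γ)
    (fstar δ g : (Fin d → ℝ) → ℝ → ℝ) (gx : (Fin d → ℝ) → ℝ)
    (ε : (Fin d → ℝ) → ℝ) (hε_meas : Measurable ε)
    (hε_nonneg : ∀ x, 0 ≤ ε x) (hε_lt : ∀ x, ε x < 1)
    (hfstar_meas : Measurable (Function.uncurry fstar))
    (hδ_meas : Measurable (Function.uncurry δ))
    (hgx_meas : Measurable gx)
    (hfstar_nonneg : ∀ x y, 0 ≤ fstar x y) (hδ_nonneg : ∀ x y, 0 ≤ δ x y)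
    (hgx_nonneg : ∀ x, 0 ≤ gx x)
    (hfstar_dens : ∀ᵐ x : Fin d → ℝ ∂volume, ∫ y : ℝ, fstar x y = 1)
    (hδ_dens : ∀ᵐ x : Fin d → ℝ ∂volume, ∫ y : ℝ, δ x y = 1)
    (hgx_int : Integrable gx) (hgx_prob : ∫ x : Fin d → ℝ, gx x = 1)
    -- the location-scale parametric family f(y|x) = (1/σ) s((y − q(x))/σ)
    (s : ℝ → ℝ) (hs_meas : Measurable s) (hs_nonneg : ∀ z, 0 ≤ s z)
    (hs_prob : ∫ z : ℝ, s z = 1)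
    (hs_pow_int : Integrable fun z : ℝ => s z ^ (1 + γ))
    (hs_pow_pos : 0 < ∫ z : ℝ, s z ^ (1 + γ))
    (σ : ℝ) (hσ : 0 < σ) (q : (Fin d → ℝ) → ℝ) (hq : Measurable q)
    (f : (Fin d → ℝ) → ℝ → ℝ)
    (hf : ∀ x y, f x y = (1 / σ) * s ((y - q x) / σ))
    -- heterogeneous contamination
    (hg : ∀ x y, g x y = (1 - ε x) * fstar x y + ε x * δ x y)
    -- finiteness assumptions
    (hA_fin : J d γ fstar f (fun x => (1 - ε x) * gx x) ≠ ⊤)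
    (hT_fin : J d γ δ f (fun x => ε x * gx x) ≠ ⊤)
    (hεg_lt : ∫ x : Fin d → ℝ, ε x * gx x < 1) :
    dtil d γ g f gx =
      (1 - ∫ x : Fin d → ℝ, ε x * gx x) ^ (γ / (1 + γ)) *
          dtil d γ fstar f (fun x => (1 - ε x) * gx x) -
        (J d γ δ f (fun x => ε x * gx x)).toReal /
          (σ ^ (-γ) * ∫ z : ℝ, s z ^ (1 + γ)) ^ (γ / (1 + γ)) := by
  have hf_meas : Measurable (Function.uncurry f) := by
    have : Function.uncurry f = fun z => (1 / σ) * s ((z.2 - q z.1) / σ) :=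
      funext fun z => hf z.1 z.2
    rw [this]
    fun_prop
  have hεg_int : Integrable fun x => ε x * gx x :=
    hgx_int.bdd_mul (c := 1) hε_meas.aestronglyMeasurable
      (ae_of_all _ fun x => by
        rw [Real.norm_of_nonneg (hε_nonneg x)]
        exact (hε_lt x).le)
  have hsub : (fun x => (1 - ε x) * gx x) = fun x => gx x - ε x * gx x := by
    ext x
    ring
  have hw_int : Integrable fun x => (1 - ε x) * gx x := hsub ▸ hgx_int.sub hεg_int
  have hw : ∫ x, (1 - ε x) * gx x = 1 - ∫ x, ε x * gx x := by
    rw [hsub, integral_sub hgx_int hεg_int, hgx_prob]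
  have hc : 0 < 1 - ∫ x, ε x * gx x := sub_pos.2 hεg_lt
  have hK : 0 < σ ^ (-γ) * ∫ z : ℝ, s z ^ (1 + γ) := mul_pos (by positivity) hs_pow_pos
  unfold dtil
  rw [toReal_J_locationScale hγ hs_nonneg hs_pow_int hσ q hf hgx_int hgx_nonneg,
    toReal_J_locationScale hγ hs_nonneg hs_pow_int hσ q hf hw_int
      (fun x => mul_nonneg (sub_nonneg.2 (hε_lt x).le) (hgx_nonneg x)),
    hgx_prob, hw, one_mul,
    J_mixture hε_meas hε_nonneg (fun x => (hε_lt x).le) hfstar_meas hf_meas hgx_meas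
      hfstar_nonneg hδ_nonneg hg,
    ENNReal.toReal_add hA_fin hT_fin, Real.mul_rpow hc.le hK.le]
  have hca := Real.rpow_pos_of_pos hc (γ / (1 + γ))
  have hKa := Real.rpow_pos_of_pos hK (γ / (1 + γ))
  field_simp
  ring
end
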